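/- For all integers m,n with 1 ≤ m ≤ n−1: ι_m(t^(m)(n)) = (m+1)^{t^(m+1)(n)−1}, and consequently t^(m)(n) = ι_m⁻¹((m+1)^{t^(m+1)(n)−1}). Moreover, the level-m expansion of a := ι_m(t^(m)(n)) is the sequence ι_m(t^(m)(n)), ι_{m+1}(t^(m+1)(n)), …, ι_{n−1}(t^(n−1)(n)). -/

import Mathlib

open List Filter

open scoped Classical

noncomputable section

/-- The curling number of a finite string: the largest `k` such that
`S = X ++ Y^k` with `Y` nonempty; by convention `curl [] = 1`. -/
def curl (S : List ℕ) : ℕ :=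
  max 1 (sSup {k | ∃ X Y : List ℕ, Y ≠ [] ∧ S = X ++ (List.replicate k Y).flatten})

/-- The prefix of length `n` of the level-`m` Gijswijt sequence `A^(m)`. -/
def gPrefix (m : ℕ) : ℕ → List ℕ
  | 0 => []
  | n + 1 => gPrefix m n ++ [max m (curl (gPrefix m n))]

/-- `gij m p` is the `p`-th term (1-indexed) of the level-`m` Gijswijt sequence `A^(m)`. -/
def gij (m p : ℕ) : ℕ := max m (curl (gPrefix m (p - 1)))

/-- Standing hypothesis: for every `m ≥ 1`, the sets
`{k ≥ 0 : C(A^(m)[1,k]) ≤ m}` and `{k ≥ 0 : C(A^(m+1)[1,k]) ≤ m}` are infinite. -/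
def StandingHyp : Prop :=
  ∀ m : ℕ, 1 ≤ m →
    {k : ℕ | curl (gPrefix m k) ≤ m}.Infinite ∧
    {k : ℕ | curl (gPrefix (m + 1) k) ≤ m}.Infinite

/-- Length of `π^(m)(1,x)`: the `x`-th smallest (0-indexed) element of
`{k : C(A^(m)[1,k]) ≤ m}`. -/
def piLen (m x : ℕ) : ℕ := Nat.nth (fun k => curl (gPrefix m k) ≤ m) x

/-- `π^(m)(1,x)`: the prefix of `A^(m)` with exactly `x` occurrences of `m`
and curling number at most `m`. -/
def piStr (m x : ℕ) : List ℕ := gPrefix m (piLen m x)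

/-- `β^(m)(t)`, the length of `B_t^(m)`. -/
def beta (m t : ℕ) : ℕ := piLen m ((m + 1) ^ (t - 1))

/-- `B_t^(m) := π^(m)(1,(m+1)^(t-1))`. -/
def Bstr (m t : ℕ) : List ℕ := piStr m ((m + 1) ^ (t - 1))

/-- `τ^(m)(t)`, the length of `T_t^(m)`. -/
def tau (m t : ℕ) : ℕ := Nat.nth (fun k => curl (gPrefix (m + 1) k) ≤ m) (t - 1)

/-- `T_t^(m)`: the `t`-th shortest prefix of `A^(m+1)` with curling number at most `m`. -/
def Tstr (m t : ℕ) : List ℕ := gPrefix (m + 1) (tau m t)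

/-- `φ^(m)(n)`: the least `p ≥ 1` with `A^(m)(p) = n`. -/
def phi (m n : ℕ) : ℕ := sInf {p : ℕ | 1 ≤ p ∧ gij m p = n}

/-- `t^(m)(n) = 1 + log_{m+1} #\{i ≤ φ^(m)(n) : A^(m)(i) = m\}`. -/
def tfun (m n : ℕ) : ℕ := 1 + Nat.log (m + 1) ((gPrefix m (phi m n)).count m)

/-- `χ^(b)(a)`: read the base-`b` digits of `a` as base-`(b+1)` digits. -/
def chi (b a : ℕ) : ℕ := Nat.ofDigits (b + 1) (Nat.digits b a)

/-- `ι_m(t)`: read the base-`(m+2)` digits of the number of occurrences of `m+1`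
in `T_t^(m)` as base-`(m+1)` digits. -/
def iota (m t : ℕ) : ℕ :=
  Nat.ofDigits (m + 1) (Nat.digits (m + 2) ((Tstr m t).count (m + 1)))

/-- `ι_m⁻¹(p)`: the largest `x ≥ 1` with `ι_m(x) ≤ p`. -/
def iotaInv (m p : ℕ) : ℕ := sSup {x : ℕ | 1 ≤ x ∧ iota m x ≤ p}

/-- `ord_b(n)`: the `b`-adic valuation of `n`. -/
def ordb (b n : ℕ) : ℕ := sSup {z : ℕ | b ^ z ∣ n}

/-- The largest base-`b` digit of `n`. -/
def maxdigit (b n : ℕ) : ℕ := (Nat.digits b n).foldr max 0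

/-- Auxiliary function for the level-`m` expansion: `lexpAux m a k = a_{m+1+k}`. -/
def lexpAux (m a : ℕ) : ℕ → ℕ
  | 0 => a
  | k + 1 => iota (m + 1 + k) (ordb (m + 1 + k) (lexpAux m a k) + 1)

/-- `lexp m a l = a_l`, the `l`-th term of the level-`m` expansion of `a`. -/
def lexp (m a l : ℕ) : ℕ := lexpAux m a (l - (m + 1))

/-- The last element `n` of `π^(m+1)(1, χ^(m+1)(a))`; the level-`m` expansion
of `a` is `a_{m+1}, …, a_n`. -/
def levelEnd (m a : ℕ) : ℕ := (piStr (m + 1) (chi (m + 1) a)).getLastD 0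

/-- `V_m := {v ≥ 0 : C(T_{v+1}^(m+1)) ≤ m}`. -/
def Vset (m : ℕ) : Set ℕ := {v | curl (Tstr (m + 1) (v + 1)) ≤ m}

/-- `Q := {α ≥ 0 : C(T_{α+1}^(2)) = 1}`. -/
def Qset : Set ℕ := {a | curl (Tstr 2 (a + 1)) = 1}

/-- `R := {(a,b) : a ∈ Q, a < b, no suffix S of T_{a+1}^(2) with T_{a+1}^(2)·S = T_{b+1}^(2)}`. -/
def Rset : Set (ℕ × ℕ) :=
  {p | p.1 ∈ Qset ∧ p.1 < p.2 ∧
    ¬∃ S : List ℕ, S <:+ Tstr 2 (p.1 + 1) ∧ Tstr 2 (p.1 + 1) ++ S = Tstr 2 (p.2 + 1)}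

/-- The digit of `x` in base `b` at (1-indexed) position `i`, i.e. the coefficient
of `b^(i-1)`. -/
def digitAt (b x i : ℕ) : ℕ := (Nat.digits b x).getD (i - 1) 0

/-- `u` is the (1-indexed) position of the second nonzero base-`b` digit of `x`
(the first nonzero digit being at position `ord_b(x)+1`). -/
def IsSecondNonzero (b x u : ℕ) : Prop :=
  ordb b x + 1 < u ∧ digitAt b x u ≠ 0 ∧
    ∀ i, ordb b x + 1 < i → i < u → digitAt b x i = 0

/-- `𝒮_b`: pairs `(a,a')` with `1 ≤ a < a'` such that for some position `y` the
base-`b` digits of `a` and `a'` agree away from `y` and twice the `y`-th digit of `a`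
is at least the `y`-th digit of `a'`. -/
def Sset (b : ℕ) : Set (ℕ × ℕ) :=
  {p | 1 ≤ p.1 ∧ p.1 < p.2 ∧
    ∃ y : ℕ, (∀ i, i ≠ y → (Nat.digits b p.1).getD i 0 = (Nat.digits b p.2).getD i 0) ∧
      (Nat.digits b p.2).getD y 0 ≤ 2 * (Nat.digits b p.1).getD y 0}

/-- The glue string `S_t^(m)`, so that `T_{t+1}^(m) = T_t^(m) ++ glue m t`. -/
def glue (m t : ℕ) : List ℕ := (gPrefix (m + 1) (tau m (t + 1))).drop (tau m t)

/-- The strings `P_t^(m)`: `P_1^(m) = (m)` and `P_{t+1}^(m) = P_t^(m)·B_t^(m)·S_t^(m)`. -/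
def Pstr (m : ℕ) : ℕ → List ℕ
  | 0 => []
  | 1 => [m]
  | t + 2 => Pstr m (t + 1) ++ Bstr m (t + 1) ++ glue m (t + 1)

end

/-- The prefix of length `N` of the infinite word `f`. -/
def prefixWord (f : ℕ → ℕ) (N : ℕ) : List ℕ := (List.range N).map f

/-- The prefix of length `N` of `f` ends with `k` copies of a block of length `p`. -/
def EndsWithPower (f : ℕ → ℕ) (N k p : ℕ) : Prop :=
  1 ≤ p ∧ k * p ≤ N ∧ ∀ q, N ≤ q + k * p → q + p < N → f q = f (q + p)

lemma length_flatten_replicate (k : ℕ) (Y : List ℕ) :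
    (List.replicate k Y).flatten.length = k * Y.length := by
  simp

lemma flatten_replicate_succ_append (k : ℕ) (Y : List ℕ) :
    Y ++ (List.replicate k Y).flatten = (List.replicate k Y).flatten ++ Y := by
  induction k with
  | zero => simp
  | succ k ih =>
    rw [List.replicate_succ, List.flatten_cons, List.append_assoc, ← ih]

lemma getElem?_flatten_replicate_add (k q : ℕ) (Y : List ℕ) (h : q + Y.length < k * Y.length) :
    (List.replicate k Y).flatten[q + Y.length]? = (List.replicate k Y).flatten[q]? := by
  cases k with
  | zero => simp at h
  | succ k =>
    have hq : q < k * Y.length := by rw [Nat.succ_mul] at h; omega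
    rw [List.replicate_succ, List.flatten_cons, List.getElem?_append_right (by omega),
      Nat.add_sub_cancel, flatten_replicate_succ_append,
      List.getElem?_append_left (by simpa using hq)]

lemma map_range'_eq_flatten (f : ℕ → ℕ) (k p : ℕ) : ∀ s : ℕ,
    (∀ q, s ≤ q → q + p < s + k * p → f q = f (q + p)) →
    (List.range' s (k * p)).map f =
      (List.replicate k ((List.range' s p).map f)).flatten := by
  induction k with
  | zero => simp
  | succ k ih =>
    intro s h
    have hsum : (k + 1) * p = p + k * p := by ring
    have hsplit : List.range' s ((k + 1) * p) = List.range' s p ++ List.range' (s + p) (k * p) := by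
      rw [hsum, List.range'_append_1]
    rw [hsplit, List.map_append, ih (s + p) (fun q h1 h2 => h q (by omega) (by rw [hsum]; omega)),
      List.replicate_succ, List.flatten_cons]
    rcases Nat.eq_zero_or_pos k with rfl | hk
    · simp
    · have hblock : (List.range' (s + p) p).map f = (List.range' s p).map f := by
        apply List.ext_getElem
        · simp
        · intro i h1 h2
          have hi : i < p := by simpa using h1
          have hkp : p ≤ k * p := Nat.le_mul_of_pos_left p hk
          simp only [List.getElem_map, List.getElem_range', one_mul]
          rw [h (s + i) (by omega) (by rw [hsum]; omega)]
          congr 1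
          omega
      rw [hblock]

lemma exists_power_iff (f : ℕ → ℕ) (N k : ℕ) :
    (∃ X Y : List ℕ, Y ≠ [] ∧ prefixWord f N = X ++ (List.replicate k Y).flatten) ↔
      ∃ p, EndsWithPower f N k p := by
  constructor
  · rintro ⟨X, Y, hY, h⟩
    have hlen := congrArg List.length h
    simp only [prefixWord, List.length_map, List.length_range, List.length_append,
      length_flatten_replicate] at hlen
    refine ⟨Y.length, List.length_pos_of_ne_nil hY, by omega, fun q h1 h2 => ?_⟩
    have hat : ∀ i, i < N → X.length ≤ i →
        some (f i) = (List.replicate k Y).flatten[i - X.length]? := by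
      intro i hi hX
      rw [← List.getElem?_append_right hX, ← h]
      simp [prefixWord, hi]
    apply Option.some_injective
    rw [hat q (by omega) (by omega), hat (q + Y.length) h2 (by omega),
      show q + Y.length - X.length = q - X.length + Y.length by omega,
      getElem?_flatten_replicate_add _ _ _ (by omega)]
  · rintro ⟨p, hp, hkp, h⟩
    refine ⟨(List.range (N - k * p)).map f, (List.range' (N - k * p) p).map f, ?_, ?_⟩
    · intro h0
      have := congrArg List.length h0
      simp at this
      omega
    · rw [← map_range'_eq_flatten f k p (N - k * p) (fun q h1 h2 => h q (by omega) (by omega)),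
        ← List.map_append, prefixWord, List.range_eq_range', List.range_eq_range']
      congr 1
      have := List.range'_append_1 (s := 0) (m := N - k * p) (n := k * p)
      rw [zero_add] at this
      rw [this]
      congr 1
      omega

lemma le_curl_iff (f : ℕ → ℕ) (N k : ℕ) (hk : 2 ≤ k) :
    k ≤ curl (prefixWord f N) ↔ ∃ p, EndsWithPower f N k p := by
  rw [← exists_power_iff f N k, curl]
  set s : Set ℕ := {k | ∃ X Y : List ℕ, Y ≠ [] ∧
    prefixWord f N = X ++ (List.replicate k Y).flatten} with hs
  have hbdd : BddAbove s := by
    refine ⟨N, ?_⟩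
    rintro k' ⟨X, Y, hY, h⟩
    have hlen := congrArg List.length h
    simp only [prefixWord, List.length_map, List.length_range, List.length_append,
      length_flatten_replicate] at hlen
    have := Nat.le_mul_of_pos_right k' (List.length_pos_of_ne_nil hY)
    omega
  constructor
  · intro h
    have hk' : k ≤ sSup s := by
      rcases le_max_iff.1 h with h | h
      · omega
      · exact h
    have hne : s.Nonempty := by
      by_contra h0
      rw [Set.not_nonempty_iff_eq_empty.1 h0] at hk'
      simp at hk'
      omega
    obtain ⟨X, Y, hY, h⟩ := Nat.sSup_mem hne hbdd
    refine ⟨X ++ (List.replicate (sSup s - k) Y).flatten, Y, hY, ?_⟩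
    rw [h, List.append_assoc, ← List.flatten_append, ← List.replicate_add]
    congr 4
    omega
  · intro h
    exact le_max_of_le_right (le_csSup hbdd h)

lemma one_le_curl (S : List ℕ) : 1 ≤ curl S := le_max_left _ _

/-- The level-`m` Gijswijt sequence, indexed from `0`. -/
noncomputable def gijZero (m q : ℕ) : ℕ := max m (curl (gPrefix m q))

lemma gPrefix_eq_prefixWord (m N : ℕ) : gPrefix m N = prefixWord (gijZero m) N := by
  induction N with
  | zero => rfl
  | succ N ih =>
    rw [prefixWord, List.range_succ, List.map_append, ← prefixWord, ← ih]
    rfl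

lemma gijZero_eq (m q : ℕ) : gijZero m q = max m (curl (prefixWord (gijZero m) q)) := by
  rw [← gPrefix_eq_prefixWord, gijZero]

lemma gijZero_eq_iff {m q : ℕ} : gijZero m q = m ↔ curl (gPrefix m q) ≤ m := by
  simp [gijZero]

lemma le_gijZero (m q : ℕ) : m ≤ gijZero m q := le_max_left _ _

lemma count_prefixWord (f : ℕ → ℕ) (a N : ℕ) :
    (prefixWord f N).count a = Nat.count (fun q => f q = a) N := by
  induction N with
  | zero => simp [prefixWord]
  | succ N ih =>
    rw [prefixWord, List.range_succ, List.map_append, List.count_append, ← prefixWord, ih,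
      Nat.count_succ]
    simp [List.count_singleton]

lemma curl_nil : curl [] = 1 := by
  apply le_antisymm _ (one_le_curl _)
  by_contra! h
  obtain ⟨p, h1, h2, -⟩ := (le_curl_iff id 0 2 le_rfl).1 h
  omega

lemma prefixWord_congr {f g : ℕ → ℕ} {N : ℕ} (h : ∀ q < N, f q = g q) :
    prefixWord f N = prefixWord g N :=
  List.map_congr_left fun q hq => h q (List.mem_range.1 hq)

lemma le_ordb_iff {b n z : ℕ} (hb : 2 ≤ b) (hn : 1 ≤ n) : z ≤ ordb b n ↔ b ^ z ∣ n := by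
  have hbdd : BddAbove {z : ℕ | b ^ z ∣ n} :=
    ⟨n, fun z hz => (Nat.lt_pow_self (by omega)).le.trans (Nat.le_of_dvd hn hz)⟩
  have hmem : b ^ ordb b n ∣ n := Nat.sSup_mem (s := {z : ℕ | b ^ z ∣ n}) ⟨0, by simp⟩ hbdd
  exact ⟨fun h => (pow_dvd_pow b h).trans hmem, fun h => le_csSup hbdd h⟩

lemma ordb_eq_of_dvd_iff {b n n' : ℕ} (hb : 2 ≤ b) (hn : 1 ≤ n) (hn' : 1 ≤ n')
    (h : ∀ z, b ^ z ∣ n ↔ b ^ z ∣ n') : ordb b n = ordb b n' :=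
  eq_of_forall_le_iff fun z => by rw [le_ordb_iff hb hn, le_ordb_iff hb hn', h]

lemma ordb_pow {b : ℕ} (hb : 2 ≤ b) (z : ℕ) : ordb b (b ^ z) = z :=
  eq_of_forall_le_iff fun y => by
    rw [le_ordb_iff hb (Nat.one_le_pow _ _ (by omega)), Nat.pow_dvd_pow_iff_le_right (by omega)]

lemma dvd_iff_of_ordb_eq {b n n' : ℕ} (hb : 2 ≤ b) (hn : 1 ≤ n) (hn' : 1 ≤ n')
    (h : ordb b n = ordb b n') (z : ℕ) : b ^ z ∣ n ↔ b ^ z ∣ n' := by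
  rw [← le_ordb_iff hb hn, ← le_ordb_iff hb hn', h]

lemma exists_dvd_mem_Ioc {d : ℕ} (hd : 1 ≤ d) (a : ℕ) : ∃ z, a < z ∧ z ≤ a + d ∧ d ∣ z := by
  refine ⟨d * (a / d + 1), ?_, ?_, dvd_mul_right _ _⟩
  · exact Nat.lt_mul_div_succ a hd
  · rw [mul_add, mul_one]
    have := Nat.mul_div_le a d
    omega

/-- A multiple of `b ^ (ordb b j + 1)` in `(a, a + b * j]` always exists. -/
lemma exists_multiple_beyond_ordb {b j : ℕ} (hb : 2 ≤ b) (hj : 1 ≤ j) (a : ℕ) :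
    ∃ D z, D = b ^ (ordb b j + 1) ∧ ¬ D ∣ j ∧ a < z ∧ z ≤ a + b * j ∧ D ∣ z := by
  have hdvd : b ^ ordb b j ∣ j := (le_ordb_iff hb hj).1 le_rfl
  obtain ⟨z, h1, h2, h3⟩ := exists_dvd_mem_Ioc
    (Nat.one_le_pow (ordb b j + 1) b (by omega)) a
  refine ⟨_, z, rfl, fun h => ?_, h1, h2.trans ?_, h3⟩
  · have := (le_ordb_iff hb hj).2 h
    omega
  · have := Nat.mul_le_mul_left b (Nat.le_of_dvd hj hdvd)
    rw [pow_succ']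
    omega

/-- The valuation `ordb b` is not `j`-periodic on an interval of length `k * j - 1`
when `k > b`. -/
lemma not_periodic_ordb {b k a j : ℕ} (hb : 2 ≤ b) (hk : b + 1 ≤ k) (hj : 1 ≤ j)
    (h : ∀ i, a < i → i + j < a + k * j → ordb b i = ordb b (i + j)) : False := by
  obtain ⟨D, z, hD, hDj, haz, hz, hDz⟩ := exists_multiple_beyond_ordb hb hj a
  have hkj : (b + 1) * j ≤ k * j := Nat.mul_le_mul_right j hk
  have h3j : 3 * j ≤ (b + 1) * j := Nat.mul_le_mul_right j (by omega)
  rw [add_mul, one_mul] at *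
  have key : ∀ i, a < i → i + j < a + k * j → (D ∣ i ↔ D ∣ i + j) := fun i h1 h2 => by
    rw [hD]
    exact dvd_iff_of_ordb_eq hb (by omega) (by omega) (h i h1 h2) _
  rcases le_or_gt z (a + j) with hza | hza
  · exact hDj ((Nat.dvd_add_right hDz).1 ((key z haz (by omega)).1 hDz))
  · have hz' : z - j + j = z := by omega
    have hDz' : D ∣ z - j + j := by rwa [hz']
    have := (key (z - j) (by omega) (by omega)).2 hDz'
    exact hDj ((Nat.dvd_add_right this).1 hDz')

/-- If `ordb b` is `j`-periodic on `(a, a + b * j)` and does not increase at the next step, then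
`b = 2` and the valuations of both end points agree. -/
lemma periodic_ordb_base {b a j : ℕ} (hb : 2 ≤ b) (hj : 1 ≤ j)
    (h : ∀ i, a < i → i + j < a + b * j → ordb b i = ordb b (i + j))
    (hend : ordb b (a + b * j) ≤ ordb b (a + b * j - j)) :
    b = 2 ∧ 1 ≤ a ∧ ordb b a = ordb b (a + 2 * j) ∧ ordb b (a + j) ≠ ordb b (a + 2 * j) := by
  obtain ⟨D, z, hD, hDj, haz, hz, hDz⟩ := exists_multiple_beyond_ordb hb hj a
  have h2j : 2 * j ≤ b * j := Nat.mul_le_mul_right j hb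
  have key : ∀ i, a < i → i + j < a + b * j → (D ∣ i ↔ D ∣ i + j) := fun i h1 h2 => by
    rw [hD]
    exact dvd_iff_of_ordb_eq hb (by omega) (by omega) (h i h1 h2) _
  have hzle : z ≤ a + j := by
    by_contra! hza
    have hz' : z - j + j = z := by omega
    have hDz' : D ∣ z - j + j := by rwa [hz']
    have : D ∣ z - j := by
      rcases hz.lt_or_eq with hlt | heq
      · exact (key (z - j) (by omega) (by omega)).2 hDz'
      · rw [heq, hD, ← le_ordb_iff hb (by omega)]
        rw [heq, hD, ← le_ordb_iff hb (by omega)] at hDz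
        exact hDz.trans hend
    exact hDj ((Nat.dvd_add_right this).1 hDz')
  have hzge : a + b * j ≤ z + j := by
    by_contra! hlt
    exact hDj ((Nat.dvd_add_right hDz).1 ((key z haz hlt).1 hDz))
  have hbj : b * j = 2 * j := by omega
  have hb2 : b = 2 := Nat.eq_of_mul_eq_mul_right hj hbj
  obtain rfl : z = a + j := by omega
  have ha : 1 ≤ a := by
    by_contra! h0
    obtain rfl : a = 0 := by omega
    rw [zero_add] at hDz
    exact hDj hDz
  have hDy : ¬ D ∣ a + 2 * j := fun hy => by
    rw [show a + 2 * j = a + j + j by ring] at hy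
    exact hDj ((Nat.dvd_add_right hDz).1 hy)
  have hDa : ¬ D ∣ a := fun hy => hDj ((Nat.dvd_add_right hy).1 hDz)
  refine ⟨hb2, ha, ?_, fun heq => ?_⟩
  · have hjw : b ^ ordb b j ∣ j := (le_ordb_iff hb hj).1 le_rfl
    have hzw : b ^ ordb b j ∣ a + j := (pow_dvd_pow b (Nat.le_succ _)).trans (hD ▸ hDz)
    have haw : b ^ ordb b j ∣ a := (Nat.dvd_add_left hjw).1 hzw
    have hyw : b ^ ordb b j ∣ a + 2 * j := dvd_add haw (hjw.mul_left 2)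
    rw [hD, ← le_ordb_iff hb (by omega)] at hDy hDa
    rw [← le_ordb_iff hb (by omega)] at haw hyw
    omega
  · exact hDy (hD ▸ (dvd_iff_of_ordb_eq hb (by omega) (by omega) heq _).1 (hD ▸ hDz))

/-- The word `W` is the concatenation of blocks consisting of the letter `m` followed by a prefix
of `U`. The `i`-th block ends just before position `ℓ i`, and its prefix of `U` has length
`τ (ordb (m + 1) i)`, where `τ` enumerates the prefixes of `U` with curling number at
most `m`. -/
structure IsBlockWord (m : ℕ) (U W τ ℓ : ℕ → ℕ) : Prop where
  one_le : 1 ≤ m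
  lt_letter : ∀ q, m < U q
  strictMono_τ : StrictMono τ
  curl_le_iff : ∀ r, curl (prefixWord U r) ≤ m ↔ ∃ d, τ d = r
  ℓ_zero : ℓ 0 = 0
  ℓ_succ : ∀ i, ℓ (i + 1) = ℓ i + 1 + τ (ordb (m + 1) (i + 1))
  apply_ℓ : ∀ i, W (ℓ i) = m
  apply_block : ∀ i r, r < τ (ordb (m + 1) (i + 1)) → W (ℓ i + 1 + r) = U r

namespace IsBlockWord

variable {m : ℕ} {U W τ ℓ : ℕ → ℕ}

lemma strictMono_ℓ (h : IsBlockWord m U W τ ℓ) : StrictMono ℓ :=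
  strictMono_nat_of_lt_succ fun i => by rw [h.ℓ_succ]; omega

lemma exists_block (h : IsBlockWord m U W τ ℓ) (q : ℕ) : ∃ i, ℓ i ≤ q ∧ q < ℓ (i + 1) := by
  have hex : ∃ i, q < ℓ i := ⟨q + 1, h.strictMono_ℓ.le_apply⟩
  have hpos : Nat.find hex ≠ 0 := fun h0 => by
    have := Nat.find_spec hex
    rw [h0, h.ℓ_zero] at this
    omega
  obtain ⟨i, hi⟩ := Nat.exists_eq_succ_of_ne_zero hpos
  refine ⟨i, ?_, ?_⟩
  · exact not_lt.1 (Nat.find_min hex (by omega))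
  · have := Nat.find_spec hex
    rwa [hi] at this

lemma position_cases (h : IsBlockWord m U W τ ℓ) (q : ℕ) :
    (∃ i, q = ℓ i) ∨ ∃ i r, r < τ (ordb (m + 1) (i + 1)) ∧ q = ℓ i + 1 + r := by
  obtain ⟨i, h1, h2⟩ := h.exists_block q
  rcases h1.eq_or_lt with h1 | h1
  · exact Or.inl ⟨i, h1.symm⟩
  · rw [h.ℓ_succ] at h2
    exact Or.inr ⟨i, q - ℓ i - 1, by omega, by omega⟩

lemma apply_eq_iff (h : IsBlockWord m U W τ ℓ) (q : ℕ) : W q = m ↔ ∃ i, ℓ i = q := by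
  constructor
  · intro hq
    rcases h.position_cases q with ⟨i, rfl⟩ | ⟨i, r, hr, rfl⟩
    · exact ⟨i, rfl⟩
    · rw [h.apply_block i r hr] at hq
      exact absurd hq (h.lt_letter r).ne'
  · rintro ⟨i, rfl⟩
    exact h.apply_ℓ i

/-- A power at the end of a prefix of `W` either lies within the last block, or its period
consists of a whole number `j` of blocks, up to a cyclic shift. -/
lemma power_cases (h : IsBlockWord m U W τ ℓ) {N k p x : ℕ} (hx : ℓ x < N) (hN : N ≤ ℓ (x + 1))
    (hk : 2 ≤ k) (hp : EndsWithPower W N k p) :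
    ℓ x + 1 + k * p ≤ N ∨ ∃ a j, 1 ≤ j ∧ x + 1 = a + k * j ∧
      (∀ i, a ≤ i → i + j ≤ x → ℓ (i + j) = ℓ i + p) ∧
      N ≤ ℓ (a + (k - 1) * j) + p ∧ N ≤ ℓ a + k * p ∧ ∀ i < a, ℓ i + k * p < N := by
  obtain ⟨hp1, hkp, hper⟩ := hp
  rcases Nat.lt_or_ge (ℓ x + k * p) N with hlt | hge
  · left
    omega
  right
  have hmono := h.strictMono_ℓ
  obtain ⟨k, rfl⟩ : ∃ k', k = k' + 2 := ⟨k - 2, by omega⟩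
  have hexp : (k + 2) * p = k * p + p + p := by ring
  have hex : ∃ a, N ≤ ℓ a + (k + 2) * p := ⟨x, hge⟩
  set a := Nat.find hex with ha
  have haN : N ≤ ℓ a + (k + 2) * p := Nat.find_spec hex
  have hmin : ∀ i < a, ℓ i + (k + 2) * p < N := fun i hi => not_le.1 (Nat.find_min hex hi)
  have hax : a ≤ x := Nat.find_min' hex hge
  have hmem : ∀ c, ℓ c < N → c ≤ x := fun c hc => by
    have := hmono.lt_iff_lt.1 (hc.trans_le hN)
    omega
  have hup : ∀ i, a ≤ i → ℓ i + p < N → ∃ c, ℓ c = ℓ i + p := fun i hi hip => by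
    rw [← h.apply_eq_iff, ← hper (ℓ i) (by have := hmono.monotone hi; omega) hip, h.apply_ℓ]
  have hdown : ∀ i, ℓ i < N → N ≤ ℓ i - p + (k + 2) * p → p ≤ ℓ i → ∃ c, ℓ c + p = ℓ i := by
    intro i hiN hi1 hi2
    have h1 := hper (ℓ i - p) hi1 (by omega)
    rw [Nat.sub_add_cancel hi2, h.apply_ℓ, h.apply_eq_iff] at h1
    obtain ⟨c, hc⟩ := h1
    exact ⟨c, by omega⟩
  have hfirst : ℓ a + (k * p + p) < N := by
    by_contra! hcon
    have := hmono.monotone hax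
    obtain ⟨c, hc⟩ := hdown a (by omega) (by omega) (by omega)
    have hca : c < a := hmono.lt_iff_lt.1 (by omega)
    have := hmin c hca
    omega
  obtain ⟨c, hc⟩ := hup a le_rfl (by omega)
  have hac : a < c := hmono.lt_iff_lt.1 (by omega)
  obtain ⟨j, hj, rfl⟩ : ∃ j, 1 ≤ j ∧ c = a + j := ⟨c - a, by omega, by omega⟩
  have hstep : ∀ i, a ≤ i → ℓ i + p < N → ℓ (i + j) = ℓ i + p := by
    intro i hi
    induction i, hi using Nat.le_induction with
    | base => exact fun _ => hc
    | succ i hi ih =>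
      intro hip
      have hi1 : ℓ i < ℓ (i + 1) := hmono (Nat.lt_succ_self i)
      have hai := hmono.monotone hi
      have hprev := ih (by omega)
      obtain ⟨c', hc'⟩ := hup (i + 1) (by omega) hip
      have h1 : i + j < c' := hmono.lt_iff_lt.1 (by omega)
      have h2 : ℓ (i + 1 + j) ≤ ℓ c' := hmono.monotone (by omega)
      have h3 : ℓ (i + j) < ℓ (i + 1 + j) := hmono (by omega)
      obtain ⟨e, he⟩ := hdown (i + 1 + j) (by omega) (by omega) (by omega)
      have h4 : i < e := hmono.lt_iff_lt.1 (by omega)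
      have h5 : ℓ (i + 1) ≤ ℓ e := hmono.monotone h4
      omega
  have hstep' : ∀ i, a ≤ i → i + j ≤ x → ℓ (i + j) = ℓ i + p := by
    intro i hi hix
    have h1 := hmono.monotone hix
    have h2 : ℓ (a + j) ≤ ℓ (i + j) := hmono.monotone (by omega)
    obtain ⟨e, he⟩ := hdown (i + j) (by omega) (by omega) (by omega)
    have hae : a ≤ e := hmono.le_iff_le.1 (by omega)
    have h3 := hstep e hae (by omega)
    obtain rfl : e = i := by
      have := hmono.injective (h3.trans he)
      omega
    omega
  have hlast : ℓ (a + j - 1) + (k * p + p) < N := by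
    by_contra! hcon
    have h1 : ℓ (a + j - 1) < ℓ (a + j) := hmono (by omega)
    obtain ⟨e, he⟩ := hdown (a + j - 1) (by omega) (by omega) (by omega)
    have h2 : e < a := hmono.lt_iff_lt.1 (by omega)
    have := hmin e h2
    omega
  have hiter : ∀ i, a ≤ i → ℓ i + (k * p + p) < N → ∀ s ≤ k + 1, ℓ (i + s * j) = ℓ i + s * p := by
    intro i hi hiN s
    induction s with
    | zero => simp
    | succ s ih =>
      intro hs
      have h1 := ih (by omega)
      have h2 : (s + 1) * p ≤ (k + 1) * p := Nat.mul_le_mul_right p hs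
      rw [add_mul, add_mul, one_mul] at h2
      have h3 := hstep (i + s * j) (by omega) (by omega)
      rw [add_mul, add_mul, one_mul, one_mul, ← add_assoc, h3, h1, add_assoc]
  have hjexp : (k + 2) * j = (k + 1) * j + j := by ring
  have hiterlast := hiter (a + j - 1) (by omega) hlast (k + 1) le_rfl
  have hitera := hiter a le_rfl hfirst (k + 1) le_rfl
  rw [add_mul k 1 p, one_mul] at hiterlast hitera
  have hlow := hmem (a + j - 1 + (k + 1) * j) (by omega)
  have hhigh : x < a + (k + 2) * j := by
    by_contra! hcon
    have h1 := hstep' (a + (k + 1) * j) (by omega) (by omega)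
    have h2 := hmono.monotone hcon
    rw [hjexp, ← add_assoc] at h2
    omega
  refine ⟨a, j, hj, by omega, hstep', ?_, haN, hmin⟩
  show N ≤ ℓ (a + (k + 1) * j) + p
  omega

lemma ordb_eq_of_ℓ_shift (h : IsBlockWord m U W τ ℓ) {i j p : ℕ} (hi : 1 ≤ i)
    (h0 : ℓ (i - 1 + j) = ℓ (i - 1) + p) (h1 : ℓ (i + j) = ℓ i + p) :
    ordb (m + 1) i = ordb (m + 1) (i + j) := by
  obtain ⟨i, rfl⟩ : ∃ i', i = i' + 1 := ⟨i - 1, by omega⟩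
  rw [Nat.add_sub_cancel] at h0
  rw [show i + 1 + j = i + j + 1 by ring] at h1 ⊢
  rw [h.ℓ_succ, h.ℓ_succ] at h1
  exact h.strictMono_τ.injective (by omega)

lemma endsWithPower_of_lastBlock (h : IsBlockWord m U W τ ℓ) {N k p x : ℕ}
    (hN : N ≤ ℓ (x + 1)) (hp : EndsWithPower W N k p) (hin : ℓ x + 1 + k * p ≤ N) :
    EndsWithPower U (N - ℓ x - 1) k p := by
  obtain ⟨hp1, hkp, hper⟩ := hp
  rw [h.ℓ_succ] at hN
  refine ⟨hp1, by omega, fun q h1 h2 => ?_⟩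
  rw [← h.apply_block x q (by omega), ← h.apply_block x (q + p) (by omega),
    hper (ℓ x + 1 + q) (by omega) (by omega), add_assoc _ q p]

/-- Powers with exponent larger than `m + 1` lie within the last block. -/
lemma endsWithPower_of_large (h : IsBlockWord m U W τ ℓ) {N k p x : ℕ} (hx : ℓ x < N)
    (hN : N ≤ ℓ (x + 1)) (hk : m + 2 ≤ k) (hp : EndsWithPower W N k p) :
    EndsWithPower U (N - ℓ x - 1) k p := by
  have hm := h.one_le
  rcases h.power_cases hx hN (by omega) hp with hin | ⟨a, j, hj, hxa, hshift, -⟩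
  · exact h.endsWithPower_of_lastBlock hN hp hin
  · refine (not_periodic_ordb (b := m + 1) (a := a) (by omega) (by omega) hj fun i h1 h2 => ?_).elim
    exact h.ordb_eq_of_ℓ_shift (by omega) (hshift (i - 1) (by omega) (by omega))
      (hshift i (by omega) (by omega))

lemma not_endsWithPower_τ (h : IsBlockWord m U W τ ℓ) (d k p : ℕ) (hk : m + 1 ≤ k) :
    ¬ EndsWithPower U (τ d) k p := fun hp => by
  have hm := h.one_le
  have h1 := (h.curl_le_iff (τ d)).2 ⟨d, rfl⟩
  have h2 := (le_curl_iff U (τ d) k (by omega)).2 ⟨p, hp⟩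
  omega

/-- A concatenation of complete blocks does not end with an `(m + 1)`-st power. -/
lemma not_endsWithPower_ℓ (h : IsBlockWord m U W τ ℓ) (x p : ℕ) :
    ¬ EndsWithPower W (ℓ (x + 1)) (m + 1) p := by
  intro hp
  have hm := h.one_le
  have hmono := h.strictMono_ℓ
  have hlt : ℓ x < ℓ (x + 1) := hmono (Nat.lt_succ_self x)
  rcases h.power_cases hlt le_rfl (by omega) hp with
    hin | ⟨a, j, hj, hxa, hshift, hNj, hNa, hmin⟩
  · have := h.endsWithPower_of_lastBlock le_rfl hp hin
    rw [h.ℓ_succ x, show ∀ A B, A + 1 + B - A - 1 = B by omega] at this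
    exact h.not_endsWithPower_τ _ _ _ le_rfl this
  · rw [Nat.add_sub_cancel] at hNj
    have hmj : (m + 1) * j = m * j + j := by ring
    have hmj' : 1 * j ≤ m * j := Nat.mul_le_mul_right j hm
    have hxj := hshift (x - j) (by omega) (by omega)
    rw [show x - j + j = x by omega] at hxj
    have hsucc := h.ℓ_succ x
    have hsucc' := h.ℓ_succ (x - j)
    rw [show x - j + 1 = a + m * j by omega] at hsucc'
    obtain ⟨hm2, ha, hva, hne⟩ := periodic_ordb_base (b := m + 1) (a := a) (j := j) (by omega) hj
      (fun i h1 h2 => h.ordb_eq_of_ℓ_shift (by omega) (hshift (i - 1) (by omega) (by omega))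
        (hshift i (by omega) (by omega)))
      (by
        rw [← h.strictMono_τ.le_iff_le, ← hxa, show x + 1 - j = a + m * j by omega]
        omega)
    obtain rfl : m = 1 := by omega
    obtain ⟨hp1, hkp, hper⟩ := hp
    have hx1 : x + 1 = a + 2 * j := by omega
    have haj := hshift a le_rfl (by omega)
    have hajx : ℓ (a + j) ≤ ℓ x := hmono.monotone (by omega)
    have hprev := h.ℓ_succ (a - 1)
    rw [Nat.sub_add_cancel ha] at hprev
    have hmina := hmin (a - 1) (by omega)
    rw [one_mul] at hsucc' hNj
    rw [hx1] at hlt hsucc hmina hNj hNa hper hkp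
    rw [← hva] at hsucc hne
    have hτne : τ (ordb 2 (a + j)) ≠ τ (ordb 2 a) := fun he => hne (h.strictMono_τ.injective he)
    norm_num at *
    set t := τ (ordb 2 a)
    obtain ⟨s, hs⟩ : ∃ s, τ (ordb 2 (a + j)) = t + s := ⟨τ (ordb 2 (a + j)) - t, by omega⟩
    refine h.not_endsWithPower_τ (ordb 2 (a + j)) 2 s le_rfl ⟨by omega, by omega, ?_⟩
    intro q hq1 hq2
    have hxj1 : x - j + 1 = a + j := by omega
    have hW := h.apply_block (x - j) (q + s) (by norm_num; rw [hxj1]; exact hq2)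
    have hW' := h.apply_block (a - 1) q (by norm_num; rw [Nat.sub_add_cancel ha]; omega)
    rw [← hW, ← hW', hper _ (by omega) (by omega)]
    congr 1
    omega

end IsBlockWord

lemma ordb_add_pow {b c d i : ℕ} (hb : 2 ≤ b) (hc : b ^ (d + 1) ∣ c) (hi : 1 ≤ i)
    (hid : i + b ^ d < b ^ (d + 1)) : ordb b (c + i + b ^ d) = ordb b (c + i) := by
  have hlarge : ∀ z, d + 1 ≤ z → ∀ y, 1 ≤ y → y < b ^ (d + 1) → ¬ b ^ z ∣ c + y := by
    intro z hz y hy1 hy2 hdvd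
    have := Nat.le_of_dvd hy1 ((Nat.dvd_add_right hc).1 ((pow_dvd_pow b hz).trans hdvd))
    omega
  refine ordb_eq_of_dvd_iff hb (by omega) (by omega) fun z => ?_
  rcases Nat.lt_or_ge d z with hz | hz
  · rw [add_assoc]
    exact iff_of_false (hlarge z hz _ (by omega) hid) (hlarge z hz _ hi (by omega))
  · exact Nat.dvd_add_left (pow_dvd_pow b hz)

lemma ordb_add_sub_pow {b c d i : ℕ} (hb : 2 ≤ b) (hc : b ^ (d + 1) ∣ c)
    (hid : i + b ^ d = b ^ (d + 1)) : ordb b (c + i) = d := by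
  have hpos : 1 ≤ b ^ d := Nat.one_le_pow _ _ (by omega)
  have hlt : b ^ d < b ^ (d + 1) := Nat.pow_lt_pow_right (by omega) (Nat.lt_succ_self d)
  have hmid : b ^ (d + 1) ∣ c + i + b ^ d := by
    rw [add_assoc, hid]
    exact dvd_add hc dvd_rfl
  have h1 : b ^ d ∣ c + i :=
    (Nat.dvd_add_left dvd_rfl).1 ((pow_dvd_pow b (Nat.le_succ d)).trans hmid)
  have h2 : ¬ b ^ (d + 1) ∣ c + i := fun h => by
    have := Nat.le_of_dvd hpos ((Nat.dvd_add_right h).1 hmid)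
    omega
  rw [← le_ordb_iff hb (by omega)] at h1 h2
  omega

namespace IsBlockWord

variable {m : ℕ} {U W τ ℓ : ℕ → ℕ}

lemma ℓ_add_pow (h : IsBlockWord m U W τ ℓ) {c d : ℕ} (hc : (m + 1) ^ (d + 1) ∣ c) (i : ℕ)
    (hi : i + (m + 1) ^ d < (m + 1) ^ (d + 1)) :
    ℓ (c + i + (m + 1) ^ d) = ℓ (c + i) + (ℓ (c + (m + 1) ^ d) - ℓ c) := by
  have hm := h.one_le
  have hle : ℓ c ≤ ℓ (c + (m + 1) ^ d) := h.strictMono_ℓ.monotone (by omega)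
  induction i with
  | zero => rw [add_zero]; omega
  | succ i ih =>
    have ih := ih (by omega)
    have hord := ordb_add_pow (b := m + 1) (i := i + 1) (by omega) hc (by omega) hi
    have h1 := h.ℓ_succ (c + i)
    have h2 := h.ℓ_succ (c + i + (m + 1) ^ d)
    rw [show c + i + (m + 1) ^ d + 1 = c + (i + 1) + (m + 1) ^ d by ring, hord] at h2
    rw [show c + i + 1 = c + (i + 1) by ring] at h1
    omega

lemma ℓ_add_mul_pow (h : IsBlockWord m U W τ ℓ) {c d : ℕ} (hc : (m + 1) ^ (d + 1) ∣ c) (r u : ℕ)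
    (hr : r + u * (m + 1) ^ d < (m + 1) ^ (d + 1)) :
    ℓ (c + r + u * (m + 1) ^ d) = ℓ (c + r) + u * (ℓ (c + (m + 1) ^ d) - ℓ c) := by
  induction u with
  | zero => simp
  | succ u ih =>
    rw [add_mul, one_mul] at hr
    rw [add_mul u 1, add_mul u 1, one_mul, one_mul, ← add_assoc, ← add_assoc, ← ih (by omega),
      add_assoc c r]
    exact h.ℓ_add_pow hc _ (by omega)

/-- `W` is periodic from a position `ℓ c` with `(m + 1) ^ (d + 1) ∣ c` onwards, as long as the
final block is cut after at most `τ d` letters. -/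
lemma apply_add_period (h : IsBlockWord m U W τ ℓ) {c d x : ℕ} (hc : (m + 1) ^ (d + 1) ∣ c)
    (hx : x + 1 = c + (m + 1) ^ (d + 1)) {q : ℕ} (hq : ℓ c ≤ q)
    (hqx : q + (ℓ (c + (m + 1) ^ d) - ℓ c) < ℓ x + 1 + τ d) :
    W q = W (q + (ℓ (c + (m + 1) ^ d) - ℓ c)) := by
  have hm := h.one_le
  have hmono := h.strictMono_ℓ
  have hlt : (m + 1) ^ d < (m + 1) ^ (d + 1) :=
    Nat.pow_lt_pow_right (by omega) (Nat.lt_succ_self d)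
  set p := ℓ (c + (m + 1) ^ d) - ℓ c with hp
  have hbound : ∀ i, c ≤ i → ℓ i ≤ q →
      ∃ i', i = c + i' ∧ i' + (m + 1) ^ d < (m + 1) ^ (d + 1) := by
    intro i hci hiq
    refine ⟨i - c, by omega, ?_⟩
    by_contra! hcon
    obtain ⟨y, hy⟩ : ∃ y, y + 1 + (m + 1) ^ d = (m + 1) ^ (d + 1) :=
      ⟨(m + 1) ^ (d + 1) - (m + 1) ^ d - 1, by omega⟩
    have h1 := h.ℓ_add_pow hc y (by omega)
    have h2 := h.ℓ_succ (c + y)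
    rw [add_assoc c y 1, ordb_add_sub_pow (by omega) hc hy] at h2
    have h3 : ℓ (c + (y + 1)) ≤ ℓ i := hmono.monotone (by omega)
    rw [show c + y + (m + 1) ^ d = x by omega] at h1
    omega
  rcases h.position_cases q with ⟨i, rfl⟩ | ⟨i, r, hr, rfl⟩
  · obtain ⟨i', rfl, hi'⟩ := hbound i (hmono.le_iff_le.1 hq) le_rfl
    rw [← h.ℓ_add_pow hc i' hi', h.apply_ℓ, h.apply_ℓ]
  · have hci : c ≤ i := by
      have : ℓ c < ℓ (i + 1) := by rw [h.ℓ_succ]; omega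
      have := hmono.lt_iff_lt.1 this
      omega
    obtain ⟨i', rfl, hi'⟩ := hbound i hci (by omega)
    have hord : ordb (m + 1) (c + i' + 1) ≤ ordb (m + 1) (c + i' + (m + 1) ^ d + 1) := by
      have harr : c + i' + (m + 1) ^ d + 1 = c + (i' + 1) + (m + 1) ^ d := by ring
      rw [harr, add_assoc c i' 1]
      rcases Nat.lt_or_ge (i' + 1 + (m + 1) ^ d) ((m + 1) ^ (d + 1)) with hlt' | hge
      · exact (ordb_add_pow (by omega) hc (by omega) hlt').ge
      · have heq : i' + 1 + (m + 1) ^ d = (m + 1) ^ (d + 1) := by omega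
        rw [ordb_add_sub_pow (by omega) hc heq, le_ordb_iff (by omega) (by omega), add_assoc, heq]
        exact (pow_dvd_pow _ (Nat.le_succ d)).trans (dvd_add hc dvd_rfl)
    have hpos : ℓ (c + i') + 1 + r + p = ℓ (c + i' + (m + 1) ^ d) + 1 + r := by
      rw [h.ℓ_add_pow hc i' hi']
      omega
    rw [hpos, h.apply_block _ r hr,
      h.apply_block _ r (hr.trans_le (h.strictMono_τ.monotone hord))]

lemma period_pos (h : IsBlockWord m U W τ ℓ) (c d : ℕ) :
    1 ≤ ℓ (c + (m + 1) ^ d) - ℓ c := by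
  have : ℓ c < ℓ (c + (m + 1) ^ d) :=
    h.strictMono_ℓ (Nat.lt_add_of_pos_right (Nat.pow_pos (by omega)))
  omega

lemma exists_endsWithPower_truncated (h : IsBlockWord m U W τ ℓ) {x d : ℕ}
    (hd : (m + 1) ^ (d + 1) ∣ x + 1) : ∃ p, EndsWithPower W (ℓ x + 1 + τ d) (m + 1) p := by
  have hm := h.one_le
  have hle := Nat.le_of_dvd (by omega) hd
  obtain ⟨c, hx⟩ : ∃ c, x + 1 = c + (m + 1) ^ (d + 1) := ⟨x + 1 - (m + 1) ^ (d + 1), by omega⟩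
  have hc : (m + 1) ^ (d + 1) ∣ c := by
    rw [hx] at hd
    exact (Nat.dvd_add_left dvd_rfl).1 hd
  have hpow : (m + 1) ^ (d + 1) = m * (m + 1) ^ d + (m + 1) ^ d := by ring
  have hpos : 1 ≤ (m + 1) ^ d := Nat.one_le_pow _ _ (by omega)
  have hme : 1 * (m + 1) ^ d ≤ m * (m + 1) ^ d := Nat.mul_le_mul_right _ hm
  have h1 := h.ℓ_add_mul_pow hc 0 m (by omega)
  rw [add_zero] at h1
  obtain ⟨y, hy⟩ : ∃ y, y + 1 = m * (m + 1) ^ d := ⟨m * (m + 1) ^ d - 1, by omega⟩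
  have h2 := h.ℓ_add_pow hc y (by omega)
  have h3 := h.ℓ_succ (c + y)
  rw [add_assoc c y 1, ordb_add_sub_pow (by omega) hc (by omega), hy] at h3
  rw [show c + y + (m + 1) ^ d = x by omega] at h2
  have hexp := add_mul m 1 (ℓ (c + (m + 1) ^ d) - ℓ c)
  rw [one_mul] at hexp
  exact ⟨_, h.period_pos c d, by omega,
    fun q hq1 hq2 => h.apply_add_period hc hx (by omega) hq2⟩

/-- If the digit of `x` in base `m + 1` at some position is `m`, the concatenation of the first `x`
blocks ends with an `m`-th power. -/
lemma exists_endsWithPower_of_digit (h : IsBlockWord m U W τ ℓ) {c d r : ℕ}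
    (hc : (m + 1) ^ (d + 1) ∣ c) (hr : r < (m + 1) ^ d) :
    ∃ p, EndsWithPower W (ℓ (c + r + m * (m + 1) ^ d)) m p := by
  have hpow : (m + 1) ^ (d + 1) = m * (m + 1) ^ d + (m + 1) ^ d := by ring
  have h1 := h.ℓ_add_mul_pow hc r m (by omega)
  have h2 : ℓ c ≤ ℓ (c + r) := h.strictMono_ℓ.monotone (by omega)
  obtain ⟨x, hx⟩ : ∃ x, x + 1 = c + (m + 1) ^ (d + 1) := ⟨c + (m + 1) ^ (d + 1) - 1, by omega⟩
  have h3 : ℓ (c + r + m * (m + 1) ^ d) ≤ ℓ x := h.strictMono_ℓ.monotone (by omega)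
  exact ⟨_, h.period_pos c d, by omega,
    fun q hq1 hq2 => h.apply_add_period hc hx (by omega) (by omega)⟩

lemma curl_block_le (h : IsBlockWord m U W τ ℓ) {x r : ℕ}
    (hr : r < τ (ordb (m + 1) (x + 1))) :
    curl (prefixWord U r) ≤ curl (prefixWord W (ℓ x + 1 + r)) := by
  rcases Nat.lt_or_ge (curl (prefixWord U r)) 2 with hlt | hge
  · have := one_le_curl (prefixWord W (ℓ x + 1 + r))
    omega
  · obtain ⟨p, hp1, hkp, hper⟩ := (le_curl_iff U r _ hge).1 le_rfl
    refine (le_curl_iff _ _ _ hge).2 ⟨p, hp1, by omega, fun q h1 h2 => ?_⟩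
    obtain ⟨q, rfl⟩ : ∃ q', q = ℓ x + 1 + q' := ⟨q - ℓ x - 1, by omega⟩
    rw [add_assoc _ q p, h.apply_block x q (by omega), h.apply_block x (q + p) (by omega)]
    exact hper q (by omega) (by omega)

lemma max_curl_block (h : IsBlockWord m U W τ ℓ) {x r : ℕ}
    (hr : r < τ (ordb (m + 1) (x + 1))) :
    max m (curl (prefixWord W (ℓ x + 1 + r))) = max (m + 1) (curl (prefixWord U r)) := by
  have hm := h.one_le
  have hsucc := h.ℓ_succ x
  have hlow : m + 1 ≤ curl (prefixWord W (ℓ x + 1 + r)) := by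
    rcases Nat.lt_or_ge m (curl (prefixWord U r)) with hlt | hge
    · exact hlt.trans_le (h.curl_block_le hr)
    · obtain ⟨d, rfl⟩ := (h.curl_le_iff r).1 hge
      have hd := h.strictMono_τ.lt_iff_lt.1 hr
      exact (le_curl_iff _ _ _ (by omega)).2
        (h.exists_endsWithPower_truncated ((le_ordb_iff (by omega) (by omega)).1 hd))
  rw [max_eq_right (by omega)]
  refine le_antisymm ?_ (max_le hlow (h.curl_block_le hr))
  by_contra! hcon
  obtain ⟨hcon1, hcon2⟩ := max_lt_iff.1 hcon
  obtain ⟨p, hp⟩ := (le_curl_iff W _ _ (by omega)).1 (le_refl (curl (prefixWord W (ℓ x + 1 + r))))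
  have hU := h.endsWithPower_of_large (x := x) (by omega) (by omega) (by omega) hp
  rw [show ℓ x + 1 + r - ℓ x - 1 = r by omega] at hU
  have := (le_curl_iff U r _ (by omega)).2 ⟨p, hU⟩
  omega

lemma curl_ℓ_le (h : IsBlockWord m U W τ ℓ) (x : ℕ) : curl (prefixWord W (ℓ x)) ≤ m := by
  have hm := h.one_le
  cases x with
  | zero =>
    rw [h.ℓ_zero]
    exact curl_nil.trans_le hm
  | succ x =>
    by_contra! hcon
    obtain ⟨p, hp⟩ := (le_curl_iff W _ _ (by omega)).1 hcon
    exact h.not_endsWithPower_ℓ x p hp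

/-- If `U` is the level-`(m + 1)` sequence, then `W` is the level-`m` sequence. -/
lemma gijZero_eq (h : IsBlockWord m (gijZero (m + 1)) W τ ℓ) : gijZero m = W := by
  funext q
  induction q using Nat.strong_induction_on with
  | _ q ih =>
    rw [_root_.gijZero_eq, prefixWord_congr ih]
    rcases h.position_cases q with ⟨i, rfl⟩ | ⟨i, r, hr, rfl⟩
    · rw [h.apply_ℓ, max_eq_left (h.curl_ℓ_le i)]
    · rw [h.max_curl_block hr, h.apply_block i r hr, ← _root_.gijZero_eq]

end IsBlockWord

/-- Length of the `(d + 1)`-st shortest prefix of the level-`(m + 1)` sequence with curling number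
at most `m`. -/
noncomputable def glueLen (m : ℕ) : ℕ → ℕ :=
  Nat.nth (fun k => curl (gPrefix (m + 1) k) ≤ m)

/-- Total length of the first `i` blocks in the block decomposition of the level-`m` sequence. -/
noncomputable def blockPos (m : ℕ) : ℕ → ℕ
  | 0 => 0
  | i + 1 => blockPos m i + 1 + glueLen m (ordb (m + 1) (i + 1))

lemma strictMono_blockPos (m : ℕ) : StrictMono (blockPos m) :=
  strictMono_nat_of_lt_succ fun i => by rw [blockPos]; omega

/-- The structure theorem: the level-`m` sequence is built from prefixes of the level-`(m + 1)`
sequence. -/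
theorem isBlockWord_gijZero (hSH : StandingHyp) {m : ℕ} (hm : 1 ≤ m) :
    IsBlockWord m (gijZero (m + 1)) (gijZero m) (glueLen m) (blockPos m) := by
  have hex : ∃ W : ℕ → ℕ, (∀ i, W (blockPos m i) = m) ∧
      ∀ i r, r < glueLen m (ordb (m + 1) (i + 1)) →
        W (blockPos m i + 1 + r) = gijZero (m + 1) r := by
    have hmono := strictMono_blockPos m
    let start : ℕ → ℕ := fun q => Nat.findGreatest (fun i => blockPos m i ≤ q) q
    have hstart : ∀ i q, blockPos m i ≤ q → q < blockPos m (i + 1) → start q = i := by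
      intro i q h1 h2
      rw [Nat.findGreatest_eq_iff]
      refine ⟨hmono.le_apply.trans h1, fun _ => h1, fun j hj _ => ?_⟩
      have := hmono.monotone (show i + 1 ≤ j from hj)
      omega
    refine ⟨fun q => if blockPos m (start q) = q then m
      else gijZero (m + 1) (q - blockPos m (start q) - 1), fun i => ?_, fun i r hr => ?_⟩
    · simp [hstart i _ le_rfl (hmono (Nat.lt_succ_self i))]
    · have hs := hstart i (blockPos m i + 1 + r) (by omega) (by rw [blockPos]; omega)
      simp only [hs]
      rw [if_neg (by omega)]
      congr 1
      omega
  obtain ⟨W, hW1, hW2⟩ := hex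
  have hinf := (hSH m hm).2
  have hblock : IsBlockWord m (gijZero (m + 1)) W (glueLen m) (blockPos m) :=
    { one_le := hm
      lt_letter := le_gijZero (m + 1)
      strictMono_τ := Nat.nth_strictMono hinf
      curl_le_iff := fun r => by
        rw [← gPrefix_eq_prefixWord]
        have := Set.ext_iff.1 (Nat.range_nth_of_infinite hinf) r
        exact this.symm
      ℓ_zero := rfl
      ℓ_succ := fun i => rfl
      apply_ℓ := hW1
      apply_block := hW2 }
  have := hblock.gijZero_eq
  rwa [← this] at hblock

lemma piLen_eq_blockPos (hSH : StandingHyp) {m : ℕ} (hm : 1 ≤ m) : piLen m = blockPos m := by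
  have h := isBlockWord_gijZero hSH hm
  refine ((Nat.nth_strictMono (hSH m hm).1).range_inj h.strictMono_ℓ).1 ?_
  rw [Nat.range_nth_of_infinite (hSH m hm).1]
  ext q
  exact gijZero_eq_iff.symm.trans (h.apply_eq_iff q)

lemma gPrefix_count_self (m N : ℕ) :
    (gPrefix m N).count m = Nat.count (fun k => curl (gPrefix m k) ≤ m) N := by
  simp only [gPrefix_eq_prefixWord m N, count_prefixWord, gijZero_eq_iff]

lemma count_gPrefix_blockPos (hSH : StandingHyp) {m : ℕ} (hm : 1 ≤ m) (x : ℕ) :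
    (gPrefix m (blockPos m x)).count m = x := by
  rw [gPrefix_count_self, ← piLen_eq_blockPos hSH hm]
  exact Nat.count_nth_of_infinite (hSH m hm).1 x

lemma Tstr_eq (m d : ℕ) : Tstr m (d + 1) = gPrefix (m + 1) (glueLen m d) := rfl

lemma curl_gPrefix_glueLen (hSH : StandingHyp) {m : ℕ} (hm : 1 ≤ m) (d : ℕ) :
    curl (gPrefix (m + 1) (glueLen m d)) ≤ m :=
  Nat.nth_mem_of_infinite (hSH m hm).2 d

lemma exists_blockPos_eq_glueLen (hSH : StandingHyp) {m : ℕ} (hm : 1 ≤ m) (d : ℕ) :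
    ∃ x, blockPos (m + 1) x = glueLen m d := by
  rw [← (isBlockWord_gijZero hSH (by omega)).apply_eq_iff, gijZero_eq_iff]
  exact (curl_gPrefix_glueLen hSH hm d).trans (Nat.le_succ m)

/-- All base-`(m + 2)` digits of the number of letters `m + 1` in a prefix of the
level-`(m + 1)` sequence with curling number at most `m` are at most `m`. -/
lemma digit_count_Tstr_le (hSH : StandingHyp) {m : ℕ} (hm : 1 ≤ m) (t d : ℕ) :
    (Tstr m (t + 1)).count (m + 1) / (m + 2) ^ d % (m + 2) ≤ m := by
  have h := isBlockWord_gijZero hSH (show 1 ≤ m + 1 by omega)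
  have hcurl := curl_gPrefix_glueLen hSH hm t
  obtain ⟨x, hx⟩ := exists_blockPos_eq_glueLen hSH hm t
  rw [Tstr_eq]
  rw [← hx] at hcurl ⊢
  rw [count_gPrefix_blockPos hSH (by omega)]
  by_contra! hcon
  have hmod := Nat.mod_lt (x / (m + 2) ^ d) (show 0 < m + 2 by omega)
  have hdigit : x / (m + 2) ^ d % (m + 2) = m + 1 := by omega
  have hdiv1 := Nat.div_add_mod x ((m + 2) ^ d)
  have hdiv2 := Nat.div_add_mod (x / (m + 2) ^ d) (m + 2)
  rw [hdigit] at hdiv2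
  obtain ⟨p, hp⟩ := h.exists_endsWithPower_of_digit (d := d)
    (c := (m + 2) ^ (d + 1) * (x / (m + 2) ^ d / (m + 2)))
    (r := x % (m + 2) ^ d) (dvd_mul_right _ _) (Nat.mod_lt _ (Nat.pow_pos (by omega)))
  have hpos : (m + 2) ^ (d + 1) * (x / (m + 2) ^ d / (m + 2)) + x % (m + 2) ^ d +
      (m + 1) * (m + 1 + 1) ^ d = x := by
    conv_rhs => rw [← hdiv1, ← hdiv2]
    ring
  rw [hpos] at hp
  rw [gPrefix_eq_prefixWord] at hcurl
  have := (le_curl_iff _ _ _ (by omega)).2 ⟨p, hp⟩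
  omega

/-- Reading base-`b` digits in a smaller base is strictly monotone on numbers without large
digits. -/
lemma ofDigits_digits_lt {b c : ℕ} (hb : 2 ≤ b) : ∀ y x : ℕ,
    (∀ d, x / b ^ d % b < c) → x < y →
      Nat.ofDigits c (Nat.digits b x) < Nat.ofDigits c (Nat.digits b y) := by
  have hrec : ∀ y, Nat.ofDigits c (Nat.digits b y) =
      y % b + c * Nat.ofDigits c (Nat.digits b (y / b)) := by
    intro y
    rcases Nat.eq_zero_or_pos y with rfl | hy
    · simp
    · rw [Nat.digits_def' (by omega) hy, Nat.ofDigits_cons]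
  intro y
  induction y using Nat.strong_induction_on with
  | _ y ih =>
    intro x hx hxy
    rw [hrec x, hrec y]
    have hx0 := hx 0
    rw [pow_zero, Nat.div_one] at hx0
    rcases (Nat.div_le_div_right (c := b) hxy.le).eq_or_lt with heq | hlt
    · rw [heq]
      have h1 := Nat.div_add_mod x b
      have h2 := Nat.div_add_mod y b
      rw [heq] at h1
      omega
    · have hlt' := ih (y / b) (Nat.div_lt_self (by omega) hb) (x / b)
        (fun d => by simpa [Nat.div_div_eq_div_mul, ← pow_succ'] using hx (d + 1)) hlt
      have := Nat.mul_le_mul_left c hlt'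
      rw [Nat.succ_eq_add_one, mul_add, mul_one] at this
      omega

lemma strictMono_iota_succ (hSH : StandingHyp) {m : ℕ} (hm : 1 ≤ m) :
    StrictMono fun t => iota m (t + 1) := by
  intro s t hst
  refine ofDigits_digits_lt (by omega) _ _
    (fun d => Nat.lt_succ_of_le (digit_count_Tstr_le hSH hm s d)) ?_
  obtain ⟨x, hx⟩ := exists_blockPos_eq_glueLen hSH hm s
  obtain ⟨y, hy⟩ := exists_blockPos_eq_glueLen hSH hm t
  rw [Tstr_eq, Tstr_eq, ← hx, ← hy, count_gPrefix_blockPos hSH (by omega),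
    count_gPrefix_blockPos hSH (by omega), ← (strictMono_blockPos (m + 1)).lt_iff_lt, hx, hy]
  exact (isBlockWord_gijZero hSH hm).strictMono_τ hst

lemma iotaInv_iota (hSH : StandingHyp) {m : ℕ} (hm : 1 ≤ m) (t : ℕ) :
    iotaInv m (iota m (t + 1)) = t + 1 := by
  refine IsGreatest.csSup_eq ⟨⟨by omega, le_rfl⟩, ?_⟩
  rintro x ⟨hx1, hx2⟩
  obtain ⟨s, rfl⟩ : ∃ s, x = s + 1 := ⟨x - 1, by omega⟩
  have := (strictMono_iota_succ hSH hm).le_iff_le.1 hx2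
  omega

lemma phi_spec {m n : ℕ} (h : {p : ℕ | 1 ≤ p ∧ gij m p = n}.Nonempty) :
    ∃ q, phi m n = q + 1 ∧ gijZero m q = n ∧ ∀ r < q, gijZero m r ≠ n := by
  obtain ⟨h1, h2⟩ : 1 ≤ phi m n ∧ gij m (phi m n) = n := Nat.sInf_mem h
  obtain ⟨q, hq⟩ : ∃ q, phi m n = q + 1 := ⟨phi m n - 1, by omega⟩
  refine ⟨q, hq, by rwa [hq] at h2, fun r hr hrn => ?_⟩
  have hmem : r + 1 ∈ {p : ℕ | 1 ≤ p ∧ gij m p = n} := ⟨by omega, hrn⟩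
  have : phi m n ≤ r + 1 := Nat.sInf_le hmem
  omega

lemma phi_eq_of_isLeast {m n q : ℕ} (h : gijZero m q = n) (hmin : ∀ r < q, gijZero m r ≠ n) :
    phi m n = q + 1 := by
  have hmem : q + 1 ∈ {p : ℕ | 1 ≤ p ∧ gij m p = n} := ⟨by omega, h⟩
  obtain ⟨q', h1, h2, h3⟩ := phi_spec ⟨_, hmem⟩
  have hle : phi m n ≤ q + 1 := Nat.sInf_le hmem
  have : ¬ q' < q := fun hlt => hmin q' hlt h2
  omega

/-- A prefix ending with a letter that has not occurred before has curling number `1`. -/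
lemma curl_prefixWord_of_new_letter {f : ℕ → ℕ} {q : ℕ} (h : ∀ r < q, f r ≠ f q) :
    curl (prefixWord f (q + 1)) ≤ 1 := by
  by_contra! hcon
  obtain ⟨p, hp1, hp2, hp3⟩ := (le_curl_iff f (q + 1) 2 le_rfl).1 hcon
  refine h (q - p) (by omega) ?_
  rw [hp3 (q - p) (by omega) (by omega), Nat.sub_add_cancel (by omega)]

/-- For `n > m`, the first occurrence of `n` in the level-`m` sequence ends the
`(m + 1) ^ d`-th block, where `glueLen m d` is the first occurrence at level `m + 1`. -/
lemma exists_phi_eq (hSH : StandingHyp) {m n : ℕ} (hm : 1 ≤ m) (hmn : m + 1 ≤ n)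
    (hocc : {p : ℕ | 1 ≤ p ∧ gij (m + 1) p = n}.Nonempty) :
    ∃ d, phi (m + 1) n = glueLen m d ∧ phi m n = blockPos m ((m + 1) ^ d) := by
  have h := isBlockWord_gijZero hSH hm
  obtain ⟨q, hq, hqn, hmin⟩ := phi_spec hocc
  obtain ⟨d, hd⟩ := (h.curl_le_iff (q + 1)).1
    ((curl_prefixWord_of_new_letter (fun r hr => by rw [hqn]; exact hmin r hr)).trans hm)
  refine ⟨d, hq.trans hd.symm, ?_⟩
  obtain ⟨y, hy⟩ : ∃ y, (m + 1) ^ d = y + 1 :=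
    ⟨(m + 1) ^ d - 1, by have := Nat.one_le_pow d (m + 1) (by omega); omega⟩
  have hord : ordb (m + 1) (y + 1) = d := by rw [← hy, ordb_pow (by omega)]
  have hsucc := h.ℓ_succ y
  rw [hord, hd] at hsucc
  rw [hy, hsucc, ← add_assoc]
  refine phi_eq_of_isLeast ?_ fun r hr hrn => ?_
  · rw [h.apply_block y q (by rw [hord, hd]; omega), hqn]
  · rcases h.position_cases r with ⟨i, rfl⟩ | ⟨i, s, hs, rfl⟩
    · rw [h.apply_ℓ] at hrn
      omega
    · rw [h.apply_block i s hs] at hrn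
      have hqs : q ≤ s := not_lt.1 fun hlt => hmin s hlt hrn
      have hlt : glueLen m d ≤ glueLen m (ordb (m + 1) (i + 1)) := by omega
      have hdi := Nat.le_of_dvd (by omega)
        ((le_ordb_iff (by omega) (by omega)).1 (h.strictMono_τ.le_iff_le.1 hlt))
      have : blockPos m y ≤ blockPos m i := h.strictMono_ℓ.monotone (by omega)
      omega

lemma tfun_eq_of_phi_eq (hSH : StandingHyp) {m n d : ℕ} (hm : 1 ≤ m)
    (h : phi m n = blockPos m ((m + 1) ^ d)) : tfun m n = d + 1 := by
  rw [tfun, h, count_gPrefix_blockPos hSH hm, Nat.log_pow (by omega), add_comm]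

lemma phi_self (m : ℕ) (hm : 1 ≤ m) : phi m m = 1 :=
  phi_eq_of_isLeast (gijZero_eq_iff.2 (curl_nil.trans_le hm)) (by simp)

lemma glueLen_zero (hSH : StandingHyp) {m : ℕ} (hm : 1 ≤ m) : glueLen m 0 = 0 := by
  have h := isBlockWord_gijZero hSH hm
  obtain ⟨d, hd⟩ := (h.curl_le_iff 0).1 (curl_nil.trans_le hm)
  have := h.strictMono_τ.monotone (Nat.zero_le d)
  omega

lemma phi_eq_blockPos (hSH : StandingHyp) {m n : ℕ} (hm : 1 ≤ m) (hmn : m ≤ n)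
    (hocc : ∀ l, m ≤ l → l ≤ n → {p : ℕ | 1 ≤ p ∧ gij l p = n}.Nonempty) :
    phi m n = blockPos m ((m + 1) ^ (tfun m n - 1)) := by
  obtain ⟨d, hd⟩ : ∃ d, phi m n = blockPos m ((m + 1) ^ d) := by
    rcases hmn.eq_or_lt with rfl | hlt
    · refine ⟨0, ?_⟩
      have hord : ordb (m + 1) (0 + 1) = 0 := ordb_pow (b := m + 1) (by omega) 0
      rw [phi_self m hm, pow_zero, ← zero_add 1, blockPos, hord, glueLen_zero hSH hm, blockPos]
    · obtain ⟨d, -, hd⟩ := exists_phi_eq hSH hm hlt (hocc (m + 1) (by omega) hlt)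
      exact ⟨d, hd⟩
  rw [tfun_eq_of_phi_eq hSH hm hd, hd, Nat.add_sub_cancel]

lemma ofDigits_digits_pow {b c : ℕ} (hb : 2 ≤ b) (k : ℕ) :
    Nat.ofDigits c (Nat.digits b (b ^ k)) = c ^ k := by
  have := Nat.digits_base_pow_mul (b := b) (k := k) (m := 1) (by omega) (by omega)
  rw [mul_one] at this
  rw [this, Nat.ofDigits_append, Nat.ofDigits_replicate_zero,
    Nat.digits_of_lt b 1 (by omega) (by omega)]
  simp

lemma iota_tfun (hSH : StandingHyp) {m n : ℕ} (hm : 1 ≤ m) (hmn : m + 1 ≤ n)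
    (hocc : ∀ l, m ≤ l → l ≤ n → {p : ℕ | 1 ≤ p ∧ gij l p = n}.Nonempty) :
    iota m (tfun m n) = (m + 1) ^ (tfun (m + 1) n - 1) := by
  obtain ⟨d, hd1, hd2⟩ := exists_phi_eq hSH hm hmn (hocc (m + 1) (by omega) hmn)
  have hphi := phi_eq_blockPos hSH (by omega) hmn fun l h1 h2 => hocc l (by omega) h2
  rw [tfun_eq_of_phi_eq hSH hm hd2, iota, Tstr_eq, ← hd1, hphi,
    count_gPrefix_blockPos hSH (by omega), ofDigits_digits_pow (by omega)]

lemma one_le_tfun (m n : ℕ) : 1 ≤ tfun m n := Nat.le_add_right _ _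

lemma levelEnd_pow_tfun (hSH : StandingHyp) {m n : ℕ} (hm : 1 ≤ m) (hmn : m + 1 ≤ n)
    (hocc : ∀ l, m + 1 ≤ l → l ≤ n → {p : ℕ | 1 ≤ p ∧ gij l p = n}.Nonempty) :
    levelEnd m ((m + 1) ^ (tfun (m + 1) n - 1)) = n := by
  obtain ⟨q, hq, hqn, -⟩ := phi_spec (hocc (m + 1) le_rfl hmn)
  have hlast : gPrefix (m + 1) (q + 1) = gPrefix (m + 1) q ++ [gijZero (m + 1) q] := rfl
  rw [levelEnd, chi, ofDigits_digits_pow (by omega), piStr, piLen_eq_blockPos hSH (by omega),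
    ← phi_eq_blockPos hSH (by omega) hmn hocc, hq, hlast, hqn]
  simp

/-- Proposition `important level-m expansion`. For `1 ≤ m ≤ n-1`:
`ι_m(t^(m)(n)) = (m+1)^{t^(m+1)(n)-1}`, hence `t^(m)(n) = ι_m⁻¹((m+1)^{t^(m+1)(n)-1})`;
and the level-`m` expansion of `a := ι_m(t^(m)(n))` is
`ι_m(t^(m)(n)), ι_{m+1}(t^(m+1)(n)), …, ι_{n-1}(t^(n-1)(n))`. -/
theorem statement8 (hSH : StandingHyp) (m n : ℕ) (hm : 1 ≤ m) (hmn : m + 1 ≤ n)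
    (hocc : ∀ l, m ≤ l → l ≤ n → {p : ℕ | 1 ≤ p ∧ gij l p = n}.Nonempty) :
    iota m (tfun m n) = (m + 1) ^ (tfun (m + 1) n - 1) ∧
    tfun m n = iotaInv m ((m + 1) ^ (tfun (m + 1) n - 1)) ∧
    levelEnd m (iota m (tfun m n)) = n ∧
    (∀ l, m + 1 ≤ l → l ≤ n →
      lexp m (iota m (tfun m n)) l = iota (l - 1) (tfun (l - 1) n)) := by
  have hiota : ∀ l, m ≤ l → l + 1 ≤ n → iota l (tfun l n) = (l + 1) ^ (tfun (l + 1) n - 1) :=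
    fun l h1 h2 => iota_tfun hSH (by omega) h2 fun l' h3 h4 => hocc l' (by omega) h4
  have hfirst := hiota m le_rfl hmn
  refine ⟨hfirst, ?_, ?_, fun l hl hln => ?_⟩
  · have := iotaInv_iota hSH hm (tfun m n - 1)
    rw [Nat.sub_add_cancel (one_le_tfun m n)] at this
    rw [← hfirst, this]
  · rw [hfirst]
    exact levelEnd_pow_tfun hSH hm hmn fun l h1 h2 => hocc l (by omega) h2
  · obtain ⟨k, rfl⟩ : ∃ k, l = m + 1 + k := ⟨l - (m + 1), by omega⟩
    rw [lexp, Nat.add_sub_cancel_left]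
    induction k with
    | zero => rfl
    | succ k ih =>
      have hord := hiota (m + k) (by omega) (by omega)
      rw [show m + k + 1 = m + 1 + k by ring] at hord
      rw [lexpAux, ih (by omega) (by omega), show m + 1 + k - 1 = m + k by omega, hord,
        ordb_pow (by omega), Nat.sub_add_cancel (one_le_tfun _ _)]
      rfl
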